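/- The effective scaling map Υ restricts to a bijection from 𝒟 onto 𝒟̄. -/

import Mathlib

open Set Filter

noncomputable section

/-- `f ∈ 𝒞`: continuous, non-decreasing, `ℝ₊`-valued on `ℝ₊`, with `f 0 = 0`. -/
def memC (f : ℝ → ℝ) : Prop :=
  ContinuousOn f (Ici 0) ∧ MonotoneOn f (Ici 0) ∧ f 0 = 0 ∧ ∀ u ∈ Ici (0:ℝ), 0 ≤ f u

/-- `f ∈ 𝒞^↑`: member of `𝒞` that is strictly increasing and tends to `∞` at `∞`. -/
def memCup (f : ℝ → ℝ) : Prop :=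
  memC f ∧ StrictMonoOn f (Ici 0) ∧ Tendsto f atTop atTop

/-- the soliton size associated with the index `i : Fin I`, namely `i+1`, as a real number. -/
def sz {I : ℕ} (i : Fin I) : ℝ := (i : ℕ) + 1

/-- the effective-distance (integrated slot density) function `φ_i`. -/
def phi {I : ℕ} (ψ : Fin I → ℝ → ℝ) (i : Fin I) (u : ℝ) : ℝ :=
  u - ∑ j, 2 * min (sz i) (sz j) * ψ j u

/-- the top effective-distance function `φ_I` (note `min (I, j) = j` for `j ≤ I`). -/
def phiTop {I : ℕ} (ψ : Fin I → ℝ → ℝ) (u : ℝ) : ℝ :=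
  u - ∑ j, 2 * sz j * ψ j u

/-- `ψ ∈ 𝓕`. -/
def memF {I : ℕ} (ψ : Fin I → ℝ → ℝ) : Prop :=
  (∀ i, memC (ψ i)) ∧ memCup (phiTop ψ)

/-- the inverse of `f : ℝ₊ → ℝ₊` (as a function `ℝ → ℝ` supported in domain `Ici 0`). -/
def rinv (f : ℝ → ℝ) : ℝ → ℝ := Function.invFunOn f (Ici 0)

/-- the effective scaling (scattering) map `Υ`. -/
def Upsilon {I : ℕ} (ψ : Fin I → ℝ → ℝ) : Fin I → ℝ → ℝ :=
  fun i => ψ i ∘ rinv (phi ψ i)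

/-- `gammaK ψb k = γ_{I-k}`, defined by downward recursion from `γ_I = id`:
`γ_i(z) = z + ∑_{j>i} 2(j-i) ψb_j (γ_j z)`. -/
def gammaK {I : ℕ} (ψb : Fin I → ℝ → ℝ) : ℕ → ℝ → ℝ
  | 0 => fun z => z
  | k + 1 => fun z =>
      z + ∑ m ∈ (Finset.range (k + 1)).attach,
        2 * (((k + 1 : ℕ) : ℝ) - ((m : ℕ) : ℝ)) *
          (if h : (m : ℕ) < I then
              ψb ⟨I - 1 - (m : ℕ), by omega⟩ (gammaK ψb (m : ℕ) z)
            else 0)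
  termination_by k => k
  decreasing_by have hm := Finset.mem_range.mp m.2; omega

/-- `γ_i`, for `i = 0, 1, …, I`. -/
def gam {I : ℕ} (ψb : Fin I → ℝ → ℝ) (i : ℕ) : ℝ → ℝ := gammaK ψb (I - i)

/-- the spatial reconstruction (inverse scattering) map `Γ`. -/
def Gamma {I : ℕ} (ψb : Fin I → ℝ → ℝ) : Fin I → ℝ → ℝ :=
  fun i => ψb i ∘ gam ψb ((i : ℕ) + 1) ∘ rinv (gam ψb 0)

/-- the free-evolution shift `θ_t`. -/
def theta {I : ℕ} (t : ℝ) (ψb : Fin I → ℝ → ℝ) : Fin I → ℝ → ℝ :=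
  fun i z => ψb i (max (z - sz i * t) 0)

/-- `ψ ∈ 𝒟`: member of `𝓕` satisfying the density condition
`∑_i i · sup_{u₁≠u₂} (ψ_i(u₁)-ψ_i(u₂))/(φ_i(u₁)-φ_i(u₂)) < 1/2`. -/
def memD {I : ℕ} (ψ : Fin I → ℝ → ℝ) : Prop :=
  memF ψ ∧
  ∃ c : Fin I → ℝ,
    (∀ i, ∀ u₁ ∈ Ici (0:ℝ), ∀ u₂ ∈ Ici (0:ℝ), u₂ < u₁ →
      ψ i u₁ - ψ i u₂ ≤ c i * (phi ψ i u₁ - phi ψ i u₂)) ∧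
    ∑ i, sz i * c i < 1 / 2

/-- `ψb ∈ 𝒟̄`: member of `𝒞^I` satisfying the density condition
`∑_i i · sup_{z₁≠z₂} (ψb_i(z₁)-ψb_i(z₂))/(z₁-z₂) < 1/2`. -/
def memDbar {I : ℕ} (ψb : Fin I → ℝ → ℝ) : Prop :=
  (∀ i, memC (ψb i)) ∧
  ∃ c : Fin I → ℝ,
    (∀ i, ∀ z₁ ∈ Ici (0:ℝ), ∀ z₂ ∈ Ici (0:ℝ), z₂ < z₁ →
      ψb i z₁ - ψb i z₂ ≤ c i * (z₁ - z₂)) ∧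
    ∑ i, sz i * c i < 1 / 2

/-- the extension `f^ℝ` of `f` to `ℝ`, by `0` on the negative half-line. -/
def extZ (f : ℝ → ℝ) : ℝ → ℝ := fun u => if 0 ≤ u then f u else 0

/-- the extension `f^{ℝ,↑}` of `f` to `ℝ`, by the identity on the negative half-line. -/
def extId (f : ℝ → ℝ) : ℝ → ℝ := fun u => if 0 ≤ u then f u else u

/-- `f ∈ 𝒞^q`. -/
def memCq (q : ℕ) (f : ℝ → ℝ) : Prop := memC f ∧ ContDiff ℝ q (extZ f)

/-- `f ∈ 𝒞^{↑,q}`. -/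
def memCupq (q : ℕ) (f : ℝ → ℝ) : Prop := memCup f ∧ ContDiff ℝ q (extId f)

/-- `f ∈ C^q(ℝ₊², ℝ₊)`: `ℝ₊`-valued and `q`-times continuously differentiable on the
quadrant (one-sided at the boundary). -/
def memCqTwo (q : ℕ) (f : ℝ → ℝ → ℝ) : Prop :=
  (∀ u ∈ Ici (0:ℝ), ∀ t ∈ Ici (0:ℝ), 0 ≤ f u t) ∧
  ContDiffOn ℝ q (fun p : ℝ × ℝ => f p.1 p.2) (Ici 0 ×ˢ Ici 0)

/-- the matrix `M(ρ)`. -/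
def Mmat {I : ℕ} (ρ : Fin I → ℝ) : Matrix (Fin I) (Fin I) ℝ :=
  Matrix.of fun i j =>
    if i = j then 1 - ∑ k ∈ Finset.univ.erase i, 2 * min (sz i) (sz k) * ρ k
    else 2 * min (sz i) (sz j) * ρ j

/-- the effective speeds `v^eff(ρ) = M(ρ)⁻¹ v`, where `v_i = i`. -/
def veff {I : ℕ} (ρ : Fin I → ℝ) : Fin I → ℝ :=
  ((Mmat ρ)⁻¹).mulVec fun i => sz i

/-- `ρ ∈ 𝒟_density`. -/
def memDdensity {I : ℕ} (ρ : Fin I → ℝ → ℝ) : Prop :=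
  (∀ i, (∀ u ∈ Ici (0:ℝ), 0 ≤ ρ i u) ∧ ContDiff ℝ 1 (extZ (ρ i))) ∧
  (∀ u ∈ Ici (0:ℝ), ∑ i, 2 * sz i * ρ i u < 1) ∧
  ∃ c : Fin I → ℝ,
    (∀ i, ∀ u ∈ Ici (0:ℝ),
      ρ i u ≤ c i * (1 - ∑ j, 2 * min (sz i) (sz j) * ρ j u)) ∧
    ∑ i, sz i * c i < 1 / 2

theorem memC.congr {f g : ℝ → ℝ} (hf : memC f) (h : EqOn g f (Ici 0)) : memC g := by
  obtain ⟨hc, hm, h0, hp⟩ := hf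
  exact ⟨hc.congr h, hm.congr h.symm, (h self_mem_Ici).trans h0, fun u hu => h hu ▸ hp u hu⟩

theorem memCup.congr {f g : ℝ → ℝ} (hf : memCup f) (h : EqOn g f (Ici 0)) : memCup g := by
  obtain ⟨hc, hm, ht⟩ := hf
  refine ⟨hc.congr h, hm.congr h.symm, ht.congr' ?_⟩
  filter_upwards [eventually_ge_atTop 0] with u hu using (h hu).symm

theorem memC.comp {f g : ℝ → ℝ} (hf : memC f) (hg : memC g) : memC fun u => f (g u) := by
  obtain ⟨hfc, hfm, hf0, hfp⟩ := hf
  obtain ⟨hgc, hgm, hg0, hgp⟩ := hg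
  exact ⟨hfc.comp hgc hgp, hfm.comp hgm hgp, by simp [hg0, hf0], fun u hu => hfp _ (hgp u hu)⟩

theorem memC.const_mul {f : ℝ → ℝ} (hf : memC f) {a : ℝ} (ha : 0 ≤ a) :
    memC fun u => a * f u := by
  obtain ⟨hc, hm, h0, hp⟩ := hf
  exact ⟨hc.const_mul a, fun x hx y hy hxy => mul_le_mul_of_nonneg_left (hm hx hy hxy) ha,
    by simp [h0], fun u hu => mul_nonneg ha (hp u hu)⟩

theorem memC_sum {ι : Type*} (s : Finset ι) {f : ι → ℝ → ℝ} (hf : ∀ j, memC (f j)) :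
    memC fun u => ∑ j ∈ s, f j u :=
  ⟨continuousOn_finsetSum s fun j _ => (hf j).1,
    fun _ hx _ hy hxy => Finset.sum_le_sum fun j _ => (hf j).2.1 hx hy hxy,
    Finset.sum_eq_zero fun j _ => (hf j).2.2.1,
    fun u hu => Finset.sum_nonneg fun j _ => (hf j).2.2.2 u hu⟩

theorem memCup.add_memC {f g : ℝ → ℝ} (hf : memCup f) (hg : memC g) :
    memCup fun u => f u + g u := by
  obtain ⟨⟨hfc, hfm, hf0, hfp⟩, hfs, hft⟩ := hf
  obtain ⟨hgc, hgm, hg0, hgp⟩ := hg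
  refine ⟨⟨hfc.add hgc, hfm.add hgm, by simp [hf0, hg0],
    fun u hu => add_nonneg (hfp u hu) (hgp u hu)⟩, hfs.add_monotone hgm,
    tendsto_atTop_mono' _ ?_ hft⟩
  filter_upwards [eventually_ge_atTop 0] with u hu using le_add_of_nonneg_right (hgp u hu)

theorem memCup_id : memCup fun u => u :=
  ⟨⟨continuousOn_id, fun _ _ _ _ h => h, rfl, fun _ hu => hu⟩, fun _ _ _ _ h => h, tendsto_id⟩

theorem memCup.surjOn {f : ℝ → ℝ} (hf : memCup f) : SurjOn f (Ici 0) (Ici 0) := by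
  intro y hy
  obtain ⟨b, hb, hyb⟩ := ((eventually_ge_atTop 0).and (hf.2.2.eventually_ge_atTop y)).exists
  obtain ⟨x, hx, rfl⟩ := intermediate_value_Icc hb (hf.1.1.mono Icc_subset_Ici_self)
    ⟨hf.1.2.2.1.trans_le hy, hyb⟩
  exact ⟨x, hx.1, rfl⟩

theorem memCup.rinv_mem {f : ℝ → ℝ} (hf : memCup f) {y : ℝ} (hy : y ∈ Ici (0 : ℝ)) :
    rinv f y ∈ Ici (0 : ℝ) :=
  Function.invFunOn_mem (hf.surjOn hy)

theorem memCup.apply_rinv {f : ℝ → ℝ} (hf : memCup f) {y : ℝ} (hy : y ∈ Ici (0 : ℝ)) :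
    f (rinv f y) = y :=
  Function.invFunOn_eq (hf.surjOn hy)

theorem memCup.rinv_apply {f : ℝ → ℝ} (hf : memCup f) {u : ℝ} (hu : u ∈ Ici (0 : ℝ)) :
    rinv f (f u) = u :=
  hf.2.1.injOn (hf.rinv_mem (hf.1.2.2.2 u hu)) hu (hf.apply_rinv (hf.1.2.2.2 u hu))

/-- The inverse of a member of `𝒞^↑` is a member of `𝒞^↑`. -/
theorem memCup.rinv {f : ℝ → ℝ} (hf : memCup f) : memCup (rinv f) := by
  have hs : StrictMonoOn (_root_.rinv f) (Ici 0) := fun x hx y hy hxy => by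
    rw [← hf.2.1.lt_iff_lt (hf.rinv_mem hx) (hf.rinv_mem hy), hf.apply_rinv hx, hf.apply_rinv hy]
    exact hxy
  have h0 : _root_.rinv f 0 = 0 := by
    simpa [hf.1.2.2.1] using hf.rinv_apply (u := 0) self_mem_Ici
  have himg : _root_.rinv f '' Ici 0 = Ici 0 :=
    (image_subset_iff.2 fun y hy => hf.rinv_mem hy).antisymm
      fun u hu => ⟨f u, hf.1.2.2.2 u hu, hf.rinv_apply hu⟩
  refine ⟨⟨fun y hy => ?_, hs.monotoneOn, h0, fun y hy => hf.rinv_mem hy⟩, hs,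
    tendsto_atTop.2 fun b => ?_⟩
  · rcases eq_or_lt_of_le (show (0 : ℝ) ≤ y from hy) with rfl | hy'
    · refine hs.continuousWithinAt_right_of_image_mem_nhdsWithin self_mem_nhdsWithin ?_
      rw [himg, h0]
      exact self_mem_nhdsWithin
    · refine (hs.continuousAt_of_image_mem_nhds (Ici_mem_nhds hy') ?_).continuousWithinAt
      rw [himg]
      exact Ici_mem_nhds (h0 ▸ hs self_mem_Ici hy hy')
  · have hb : max b 0 ∈ Ici (0 : ℝ) := le_max_right b 0
    filter_upwards [eventually_ge_atTop (f (max b 0))] with y hy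
    have hfb := hf.1.2.2.2 _ hb
    calc b ≤ max b 0 := le_max_left b 0
      _ = _root_.rinv f (f (max b 0)) := (hf.rinv_apply hb).symm
      _ ≤ _root_.rinv f y := hs.monotoneOn hfb (hfb.trans hy) hy

/-- The recursion defining `gam`, as a sum over all soliton sizes: the coefficients of the sizes
at most `i` vanish. -/
theorem gam_eq {I : ℕ} (ψb : Fin I → ℝ → ℝ) {i : ℕ} (hi : i ≤ I) (z : ℝ) :
    gam ψb i z = z + ∑ j : Fin I, 2 * (sz j - min (i : ℝ) (sz j)) * ψb j (gam ψb (j + 1) z) := by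
  have key : ∀ k ≤ I, gammaK ψb k z = z + ∑ m ∈ Finset.range k, 2 * ((k : ℝ) - m) *
      (if h : m < I then ψb ⟨I - 1 - m, by omega⟩ (gammaK ψb m z) else 0) := by
    rintro (_ | k) _
    · simp [gammaK]
    · rw [gammaK]
      exact congrArg (z + ·) (Finset.sum_attach (Finset.range (k + 1)) fun m =>
        2 * (((k + 1 : ℕ) : ℝ) - (m : ℝ)) *
          (if h : m < I then ψb ⟨I - 1 - m, by omega⟩ (gammaK ψb m z) else 0))
  rw [gam, key _ (Nat.sub_le I i)]
  congr 1
  rw [← Equiv.sum_comp Fin.revPerm, Finset.sum_fin_eq_sum_range]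
  refine Finset.sum_subset_zero_on_sdiff (Finset.range_subset_range.2 (Nat.sub_le I i))
    (fun m hm => ?_) fun m hm => ?_
  · obtain ⟨hm, hmi⟩ := Finset.mem_sdiff.1 hm
    rw [Finset.mem_range] at hm hmi
    have h : ((I - (m + 1) : ℕ) : ℝ) + 1 ≤ i := by exact_mod_cast (by omega : I - (m + 1) + 1 ≤ i)
    simp only [hm, dite_true, sz, Fin.revPerm_apply, Fin.val_rev, min_eq_right h, sub_self,
      mul_zero, zero_mul]
  · rw [Finset.mem_range] at hm
    have hmI : m < I := by omega
    have h : (i : ℝ) ≤ ((I - (m + 1) : ℕ) : ℝ) + 1 := by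
      exact_mod_cast (by omega : i ≤ I - (m + 1) + 1)
    have hrev : (⟨m, hmI⟩ : Fin I).rev = ⟨I - 1 - m, by omega⟩ := by
      ext; simp [Fin.val_rev]; omega
    have hsub : I - (I - 1 - m + 1) = m := by omega
    have hcoef : ((I - i : ℕ) : ℝ) - m = ((I - 1 - m : ℕ) : ℝ) + 1 - i := by
      rw [Nat.cast_sub hi, Nat.sub_sub, Nat.cast_sub (by omega)]
      push_cast
      ring
    have hmin : (i : ℝ) ≤ ((I - 1 - m : ℕ) : ℝ) + 1 := by
      exact_mod_cast (by omega : i ≤ I - 1 - m + 1)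
    simp only [hmI, dite_true, Fin.revPerm_apply, hrev, gam, hsub, sz, hcoef, min_eq_left hmin]

theorem phi_eq {I : ℕ} (ψ : Fin I → ℝ → ℝ) (i : Fin I) (u : ℝ) :
    phi ψ i u = phiTop ψ u + ∑ j, 2 * (sz j - min (sz i) (sz j)) * ψ j u := by
  simp only [phi, phiTop, mul_sub, sub_mul, Finset.sum_sub_distrib]
  ring

theorem sz_pos {I : ℕ} (i : Fin I) : 0 < sz i := by
  unfold sz; positivity

theorem sz_eq_cast {I : ℕ} (i : Fin I) : sz i = ((i + 1 : ℕ) : ℝ) := by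
  simp [sz]

theorem two_mul_sz_sub_min_nonneg {I : ℕ} (x : ℝ) (j : Fin I) :
    0 ≤ 2 * (sz j - min x (sz j)) :=
  mul_nonneg zero_le_two (sub_nonneg.2 (min_le_right _ _))

/-- Downward induction along the recursion defining `gam`. -/
theorem downward_induction {I : ℕ} {p : ℕ → Prop}
    (h : ∀ i ≤ I, (∀ j : Fin I, i < j + 1 → p (j + 1)) → p i) {i : ℕ} (hi : i ≤ I) : p i := by
  induction hk : I - i using Nat.strong_induction_on generalizing i with
  | _ k ih => exact h i hi fun j hj => ih _ (by omega) (by omega) rfl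

theorem memCup_gam {I : ℕ} {ψb : Fin I → ℝ → ℝ} (hψb : ∀ i, memC (ψb i)) {i : ℕ} (hi : i ≤ I) :
    memCup (gam ψb i) := by
  refine downward_induction (p := fun i => memCup (gam ψb i)) (fun i hi ih => ?_) hi
  rw [funext (gam_eq ψb hi)]
  refine memCup_id.add_memC (memC_sum _ fun j => ?_)
  by_cases hj : i < j + 1
  · exact ((hψb j).comp (ih j hj).1).const_mul (two_mul_sz_sub_min_nonneg _ j)
  · have h : sz j ≤ i := by rw [sz_eq_cast]; exact_mod_cast not_lt.1 hj
    simpa [min_eq_right h] using memCup_id.1.const_mul le_rfl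

theorem memF.memCup_phi {I : ℕ} {ψ : Fin I → ℝ → ℝ} (hψ : memF ψ) (i : Fin I) :
    memCup (phi ψ i) := by
  rw [funext (phi_eq ψ i)]
  exact hψ.2.add_memC
    (memC_sum _ fun j => (hψ.1 j).const_mul (two_mul_sz_sub_min_nonneg _ j))

theorem memF.memC_Upsilon {I : ℕ} {ψ : Fin I → ℝ → ℝ} (hψ : memF ψ) (i : Fin I) :
    memC (Upsilon ψ i) :=
  (hψ.1 i).comp (hψ.memCup_phi i).rinv.1

theorem memF.Upsilon_phi {I : ℕ} {ψ : Fin I → ℝ → ℝ} (hψ : memF ψ) (i : Fin I) {u : ℝ}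
    (hu : u ∈ Ici (0 : ℝ)) : Upsilon ψ i (phi ψ i u) = ψ i u :=
  congrArg (ψ i) ((hψ.memCup_phi i).rinv_apply hu)

theorem memF.gam_Upsilon_phiTop {I : ℕ} {ψ : Fin I → ℝ → ℝ} (hψ : memF ψ) {i : ℕ} (hi : i ≤ I)
    {u : ℝ} (hu : u ∈ Ici (0 : ℝ)) :
    gam (Upsilon ψ) i (phiTop ψ u) =
      phiTop ψ u + ∑ j, 2 * (sz j - min (i : ℝ) (sz j)) * ψ j u := by
  refine downward_induction (p := fun i => gam (Upsilon ψ) i (phiTop ψ u) =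
    phiTop ψ u + ∑ j, 2 * (sz j - min (i : ℝ) (sz j)) * ψ j u) (fun i hi ih => ?_) hi
  rw [gam_eq _ hi]
  congr 1
  refine Finset.sum_congr rfl fun j _ => ?_
  by_cases hj : i < j + 1
  · rw [ih j hj, ← sz_eq_cast, ← phi_eq, hψ.Upsilon_phi j hu]
  · have h : sz j ≤ i := by rw [sz_eq_cast]; exact_mod_cast not_lt.1 hj
    simp [min_eq_right h]

theorem memF.Gamma_Upsilon {I : ℕ} {ψ : Fin I → ℝ → ℝ} (hψ : memF ψ) (i : Fin I) :
    EqOn (Gamma (Upsilon ψ) i) (ψ i) (Ici 0) := by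
  intro u hu
  have hγ₀ : gam (Upsilon ψ) 0 (phiTop ψ u) = u := by
    rw [hψ.gam_Upsilon_phiTop (Nat.zero_le I) hu]
    simp [phiTop, (sz_pos _).le]
  have hinv : rinv (gam (Upsilon ψ) 0) u = phiTop ψ u := by
    simpa only [hγ₀] using (memCup_gam hψ.memC_Upsilon (Nat.zero_le I)).rinv_apply
      (hψ.2.1.2.2.2 u hu)
  simp only [Gamma, Function.comp_apply]
  rw [hinv, hψ.gam_Upsilon_phiTop i.2 hu, ← sz_eq_cast, ← phi_eq, hψ.Upsilon_phi i hu]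

theorem phiTop_Gamma {I : ℕ} {ψb : Fin I → ℝ → ℝ} (hψb : ∀ i, memC (ψb i)) :
    EqOn (phiTop (Gamma ψb)) (rinv (gam ψb 0)) (Ici 0) := by
  intro u hu
  have h := gam_eq ψb (Nat.zero_le I) (rinv (gam ψb 0) u)
  rw [(memCup_gam hψb (Nat.zero_le I)).apply_rinv hu] at h
  simp only [Nat.cast_zero, min_eq_left (sz_pos _).le, sub_zero] at h
  exact sub_eq_of_eq_add h

theorem phi_Gamma {I : ℕ} {ψb : Fin I → ℝ → ℝ} (hψb : ∀ i, memC (ψb i)) (i : Fin I) {u : ℝ}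
    (hu : u ∈ Ici (0 : ℝ)) :
    phi (Gamma ψb) i u = gam ψb (i + 1) (rinv (gam ψb 0) u) := by
  rw [phi_eq, phiTop_Gamma hψb hu, gam_eq ψb i.2, sz_eq_cast]
  rfl

theorem memF_Gamma {I : ℕ} {ψb : Fin I → ℝ → ℝ} (hψb : ∀ i, memC (ψb i)) : memF (Gamma ψb) :=
  have hinv := (memCup_gam hψb (Nat.zero_le I)).rinv
  ⟨fun i => (hψb i).comp ((memCup_gam hψb i.2).1.comp hinv.1), hinv.congr (phiTop_Gamma hψb)⟩

theorem Gamma_eq_phi {I : ℕ} {ψb : Fin I → ℝ → ℝ} (hψb : ∀ i, memC (ψb i)) (i : Fin I) {u : ℝ}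
    (hu : u ∈ Ici (0 : ℝ)) : Gamma ψb i u = ψb i (phi (Gamma ψb) i u) :=
  congrArg (ψb i) (phi_Gamma hψb i hu).symm

/-- `Υ` restricts to a bijection from `𝒟` onto `𝒟̄` (with inverse `Γ`). -/
theorem stmt_6 {I : ℕ} (hI : 1 ≤ I) :
    (∀ ψ : Fin I → ℝ → ℝ, memD ψ →
      memDbar (Upsilon ψ) ∧ ∀ i, EqOn (Gamma (Upsilon ψ) i) (ψ i) (Ici 0)) ∧
    (∀ ψb : Fin I → ℝ → ℝ, memDbar ψb →
      memD (Gamma ψb) ∧ ∀ i, EqOn (Upsilon (Gamma ψb) i) (ψb i) (Ici 0)) := by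
  refine ⟨fun ψ ⟨hF, c, hc, hsum⟩ => ⟨⟨hF.memC_Upsilon, c, fun i z₁ hz₁ z₂ hz₂ h => ?_, hsum⟩,
    hF.Gamma_Upsilon⟩, fun ψb ⟨hC, c, hc, hsum⟩ => ?_⟩
  · have hφ := hF.memCup_phi i
    simpa only [Upsilon, Function.comp_apply, hφ.apply_rinv hz₁, hφ.apply_rinv hz₂] using
      hc i _ (hφ.rinv_mem hz₁) _ (hφ.rinv_mem hz₂) (hφ.rinv.2.1 hz₂ hz₁ h)
  · have hF := memF_Gamma hC
    refine ⟨⟨hF, c, fun i u₁ hu₁ u₂ hu₂ h => ?_, hsum⟩, fun i z hz => ?_⟩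
    · have hφ := hF.memCup_phi i
      rw [Gamma_eq_phi hC i hu₁, Gamma_eq_phi hC i hu₂]
      exact hc i _ (hφ.1.2.2.2 _ hu₁) _ (hφ.1.2.2.2 _ hu₂) (hφ.2.1 hu₂ hu₁ h)
    · have hφ := hF.memCup_phi i
      simp only [Upsilon, Function.comp_apply]
      rw [Gamma_eq_phi hC i (hφ.rinv_mem hz), hφ.apply_rinv hz]
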